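/- Let ρ and σ be 2^n×2^n density matrices. Define, for each c > 0, h(c) = sSup {λ·Re Tr[τρ] − λ·Re Tr[τσ] − c·‖I − λτ − μω‖₂² : λ ≥ 0, μ ≥ 0, τ and ω are 2^n×2^n density matrices}. Then lim_{c→∞} h(c) = sSup {Re Tr[Λ(ρ − σ)] : Λ a 2^n×2^n positive semidefinite matrix with I − Λ positive semidefinite}. -/

import Mathlib

open Matrix Filter
open scoped ComplexOrder

noncomputable section

/-- The Hilbert–Schmidt (Frobenius) norm of a complex matrix. -/
def hsNorm {ι : Type*} [Fintype ι] (M : Matrix ι ι ℂ) : ℝ :=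
  Real.sqrt ((Mᴴ * M).trace.re)

/-- The trace of a product of two positive semidefinite matrices has nonnegative real part. -/
lemma re_trace_mul_nonneg {ι : Type*} [Fintype ι] [DecidableEq ι] {A B : Matrix ι ι ℂ}
    (hA : A.PosSemidef) (hB : B.PosSemidef) : 0 ≤ ((A * B).trace).re := by
  obtain ⟨C, rfl⟩ : ∃ C : Matrix ι ι ℂ, B = Cᴴ * C := by
    open scoped MatrixOrder in
    exact CStarAlgebra.nonneg_iff_eq_star_mul_self.mp hB.nonneg
  rw [← Matrix.mul_assoc, Matrix.trace_mul_comm, ← Matrix.mul_assoc]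
  exact (Complex.nonneg_iff.mp (hA.mul_mul_conjTranspose_same C).trace_nonneg).1

lemma hsNorm_nonneg {ι : Type*} [Fintype ι] (M : Matrix ι ι ℂ) : 0 ≤ hsNorm M :=
  Real.sqrt_nonneg _

/-- A Hermitian matrix is bounded below by minus its Hilbert–Schmidt norm. -/
lemma posSemidef_add_hsNorm {ι : Type*} [Fintype ι] [DecidableEq ι] {R : Matrix ι ι ℂ}
    (hR : R.IsHermitian) : (R + (hsNorm R : ℂ) • (1 : Matrix ι ι ℂ)).PosSemidef := by
  set U : Matrix ι ι ℂ := (hR.eigenvectorUnitary : Matrix ι ι ℂ)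
  set D : Matrix ι ι ℂ := diagonal fun i => (hR.eigenvalues i : ℂ) with hD
  have hUU : U * Uᴴ = 1 := Unitary.coe_mul_star_self hR.eigenvectorUnitary
  have hUU' : Uᴴ * U = 1 := Unitary.coe_star_mul_self hR.eigenvectorUnitary
  have hspec : R = U * D * Uᴴ := hR.spectral_theorem
  have htr : (Rᴴ * R).trace.re = ∑ i, hR.eigenvalues i ^ 2 := by
    have hsq : R * R = U * (D * D) * Uᴴ := by
      calc R * R = (U * D * Uᴴ) * (U * D * Uᴴ) := by rw [← hspec]
        _ = U * D * (Uᴴ * U) * D * Uᴴ := by simp only [Matrix.mul_assoc]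
        _ = U * (D * D) * Uᴴ := by rw [hUU', Matrix.mul_one, Matrix.mul_assoc U]
    rw [hR.eq, hsq, Matrix.trace_mul_comm, ← Matrix.mul_assoc, hUU', Matrix.one_mul, hD,
      diagonal_mul_diagonal, trace_diagonal, Complex.re_sum]
    exact Finset.sum_congr rfl fun i _ => by simp [sq]
  have hle (i : ι) : 0 ≤ hR.eigenvalues i + hsNorm R := by
    have : |hR.eigenvalues i| ≤ hsNorm R := by
      rw [hsNorm, htr]
      exact Real.abs_le_sqrt
        (Finset.single_le_sum (f := fun i => hR.eigenvalues i ^ 2)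
          (fun j _ => sq_nonneg _) (Finset.mem_univ i))
    linarith [neg_abs_le (hR.eigenvalues i)]
  have hdiag : (diagonal fun i => ((hR.eigenvalues i + hsNorm R : ℝ) : ℂ)).PosSemidef :=
    PosSemidef.diagonal fun i => by simpa using Complex.zero_le_real.mpr (hle i)
  have heq : R + (hsNorm R : ℂ) • (1 : Matrix ι ι ℂ)
      = U * (diagonal fun i => ((hR.eigenvalues i + hsNorm R : ℝ) : ℂ)) * Uᴴ := by
    have : (diagonal fun i => ((hR.eigenvalues i + hsNorm R : ℝ) : ℂ))
        = D + (hsNorm R : ℂ) • (1 : Matrix ι ι ℂ) := by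
      rw [hD, ← diagonal_one, ← diagonal_smul, diagonal_add]
      congr 1
      ext i
      simp
    rw [this, Matrix.mul_add, Matrix.add_mul, ← hspec, Matrix.mul_smul, Matrix.smul_mul,
      Matrix.mul_one, hUU]
  rw [heq]
  exact hdiag.mul_mul_conjTranspose_same U

/-- Every positive semidefinite matrix is a nonnegative multiple of a density matrix. -/
lemma exists_smul_density {ι : Type*} [Fintype ι] [DecidableEq ι] {A ρ : Matrix ι ι ℂ}
    (hA : A.PosSemidef) (hρ : ρ.PosSemidef ∧ ρ.trace = 1) :
    ∃ (a : ℝ) (τ : Matrix ι ι ℂ), 0 ≤ a ∧ (τ.PosSemidef ∧ τ.trace = 1) ∧ a • τ = A := by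
  obtain ⟨hre, him⟩ := Complex.nonneg_iff.mp hA.trace_nonneg
  have htr : A.trace = (A.trace.re : ℂ) := Complex.ext rfl (by simpa using him.symm)
  by_cases h : A.trace.re = 0
  · refine ⟨0, ρ, le_rfl, hρ, ?_⟩
    rw [zero_smul, hA.trace_eq_zero_iff.mp (by rw [htr, h, Complex.ofReal_zero])]
  · refine ⟨A.trace.re, A.trace.re⁻¹ • A, hre, ⟨hA.smul (inv_nonneg.mpr hre), ?_⟩, ?_⟩
    · rw [trace_smul, htr, Complex.real_smul, Complex.ofReal_re, Complex.ofReal_inv]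
      exact inv_mul_cancel₀ (Complex.ofReal_ne_zero.mpr h)
    · rw [smul_smul, mul_inv_cancel₀ h, one_smul]

/-- If `A` and `B` are positive semidefinite, scaling `A` down by `1 + ‖1 - A - B‖₂` yields an
operator between `0` and `1`. -/
lemma posSemidef_one_sub_inv_smul {ι : Type*} [Fintype ι] [DecidableEq ι] {A B : Matrix ι ι ℂ}
    (hA : A.PosSemidef) (hB : B.PosSemidef) :
    (1 - (1 + hsNorm (1 - A - B))⁻¹ • A).PosSemidef := by
  set r := hsNorm (1 - A - B) with hr
  have hr0 : 0 < 1 + r := by linarith [hsNorm_nonneg (1 - A - B)]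
  have hR : (1 - A - B).IsHermitian := (isHermitian_one.sub hA.1).sub hB.1
  have h := ((posSemidef_add_hsNorm hR).add hB).smul (inv_nonneg.mpr hr0.le)
  convert h using 1
  rw [← hr, show 1 - A - B + (r : ℂ) • (1 : Matrix ι ι ℂ) + B = (1 + r) • 1 - A by
    rw [add_smul, one_smul, Complex.coe_smul]; abel, smul_sub, smul_smul,
    inv_mul_cancel₀ hr0.ne', one_smul]

theorem trace_distance_primal_qslack (n : ℕ)
    (ρ σ : Matrix (Fin (2^n)) (Fin (2^n)) ℂ)
    (hρ : ρ.PosSemidef ∧ ρ.trace = 1) (hσ : σ.PosSemidef ∧ σ.trace = 1) :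
    Tendsto (fun c : ℝ =>
        sSup {v : ℝ | ∃ (lam mu : ℝ) (τ ω : Matrix (Fin (2^n)) (Fin (2^n)) ℂ),
          0 ≤ lam ∧ 0 ≤ mu ∧
          (τ.PosSemidef ∧ τ.trace = 1) ∧ (ω.PosSemidef ∧ ω.trace = 1) ∧
          v = lam * ((τ * ρ).trace).re - lam * ((τ * σ).trace).re
              - c * (hsNorm (1 - lam • τ - mu • ω))^2})
      atTop
      (nhds (sSup {v : ℝ | ∃ Λ : Matrix (Fin (2^n)) (Fin (2^n)) ℂ,
        Λ.PosSemidef ∧ (1 - Λ).PosSemidef ∧ v = ((Λ * (ρ - σ)).trace).re})) := by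
  set S : Set ℝ := {v : ℝ | ∃ Λ : Matrix (Fin (2^n)) (Fin (2^n)) ℂ,
        Λ.PosSemidef ∧ (1 - Λ).PosSemidef ∧ v = ((Λ * (ρ - σ)).trace).re}
  have hSbdd : BddAbove S := by
    refine ⟨1, ?_⟩
    rintro v ⟨Λ, hΛ, hΛ', rfl⟩
    have h1 := re_trace_mul_nonneg hΛ' hρ.1
    have h2 := re_trace_mul_nonneg hΛ hσ.1
    rw [Matrix.sub_mul, Matrix.one_mul, trace_sub, hρ.2, Complex.sub_re, Complex.one_re] at h1
    rw [Matrix.mul_sub, trace_sub, Complex.sub_re]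
    linarith
  have hSne : S.Nonempty :=
    ⟨_, 0, PosSemidef.zero, by simpa using PosSemidef.one, rfl⟩
  have hval (a : ℝ) (τ : Matrix (Fin (2^n)) (Fin (2^n)) ℂ) :
      a * ((τ * ρ).trace).re - a * ((τ * σ).trace).re = (((a • τ) * (ρ - σ)).trace).re := by
    simp [mul_sub]
  have hupper (c : ℝ) (hc : 0 < c) (lam mu : ℝ) (τ ω : Matrix (Fin (2^n)) (Fin (2^n)) ℂ)
      (hlam : 0 ≤ lam) (hmu : 0 ≤ mu) (hτ : τ.PosSemidef) (hω : ω.PosSemidef) :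
      lam * ((τ * ρ).trace).re - lam * ((τ * σ).trace).re
        - c * (hsNorm (1 - lam • τ - mu • ω))^2 ≤ sSup S + (sSup S) ^ 2 / 4 / c := by
    have hA := hτ.smul hlam
    have hB := hω.smul hmu
    rw [hval]
    set A := lam • τ
    set r := hsNorm (1 - A - mu • ω)
    have hr0 : 0 < 1 + r := by linarith [hsNorm_nonneg (1 - A - mu • ω)]
    have hle : (1 + r)⁻¹ * ((A * (ρ - σ)).trace).re ≤ sSup S :=
      le_csSup hSbdd ⟨(1 + r)⁻¹ • A, hA.smul (inv_nonneg.mpr hr0.le),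
        posSemidef_one_sub_inv_smul hA hB, by
          rw [Matrix.smul_mul (1 + r)⁻¹ A, trace_smul, Complex.smul_re, smul_eq_mul]⟩
    rw [inv_mul_le_iff₀ hr0] at hle
    have hsq : r * sSup S - c * r ^ 2 ≤ (sSup S) ^ 2 / 4 / c := by
      rw [le_div_iff₀ hc]
      nlinarith [sq_nonneg (c * r - sSup S / 2)]
    linarith
  have hlim : Tendsto (fun c : ℝ => sSup S + (sSup S) ^ 2 / 4 / c) atTop (nhds (sSup S)) := by
    simpa using tendsto_const_nhds.add
      (tendsto_const_nhds.div_atTop (tendsto_id : Tendsto (id : ℝ → ℝ) atTop atTop))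
  refine tendsto_of_tendsto_of_tendsto_of_le_of_le' tendsto_const_nhds hlim ?_ ?_
  · filter_upwards [eventually_gt_atTop 0] with c hc
    refine csSup_le hSne ?_
    rintro v ⟨Λ, hΛ, hΛ', rfl⟩
    obtain ⟨a, τ, ha, hτ, rfl⟩ := exists_smul_density hΛ hρ
    obtain ⟨b, ω, hb, hω, hbω⟩ := exists_smul_density hΛ' hρ
    refine le_csSup ⟨sSup S + (sSup S) ^ 2 / 4 / c, ?_⟩
      ⟨a, b, τ, ω, ha, hb, hτ, hω, ?_⟩
    · rintro v ⟨lam, mu, τ', ω', hlam, hmu, hτ', hω', rfl⟩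
      exact hupper c hc lam mu τ' ω' hlam hmu hτ'.1 hω'.1
    · rw [hval, hbω]
      simp [hsNorm]
  · filter_upwards [eventually_gt_atTop 0] with c hc
    refine csSup_le ⟨_, 0, 0, ρ, ρ, le_rfl, le_rfl, hρ, hρ, rfl⟩ ?_
    rintro v ⟨lam, mu, τ, ω, hlam, hmu, hτ, hω, rfl⟩
    exact hupper c hc lam mu τ ω hlam hmu hτ.1 hω.1
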